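/- (Theorem 1.) Consider the inverse-problem setting with exact coefficient c satisfying c(x) ≥ 0 on Ω, exact solution u, and f satisfying condition (7). The iterative process with the initial approximation specified by (16), with sufficiently smooth iterates u^k and coefficients c^k, is monotone: for every k ≥ 1, u(x,t) ≥ u^k(x,t) ≥ u^{k−1}(x,t) and c(x) ≤ c^k(x) ≤ c^{k−1}(x), for all x ∈ Ω and 0 < t ≤ T. -/

import Mathlib

noncomputable section

/-- The plane `ℝ²`. -/
abbrev E2 : Type := EuclideanSpace ℝ (Fin 2)

/-- The elliptic operator `(A v)(x) = - div (k(x) grad v(x))`. -/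
def ellOp (k : E2 → ℝ) (v : E2 → ℝ) (x : E2) : ℝ :=
  - ∑ i : Fin 2, fderiv ℝ (fun y => k y • gradient v y) x (EuclideanSpace.single i 1) i

/-- `u` solves the direct problem on `Ω × (0,T]` with diffusion coefficient `k`,
Robin boundary coefficient `μ`, reaction coefficient `c` and right-hand side `f`:
the parabolic equation, the homogeneous initial condition and the homogeneous
Robin (third-kind) boundary condition with respect to any outward unit normal. -/
structure IsDirectSolution (Ω : Set E2) (T : ℝ) (k μ : E2 → ℝ)
    (c : E2 → ℝ) (f : E2 → ℝ → ℝ) (u : E2 → ℝ → ℝ) : Prop where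
  pde : ∀ x ∈ Ω, ∀ t : ℝ, 0 < t → t ≤ T →
    deriv (u x) t + ellOp k (fun y => u y t) x + c x * u x t = f x t
  ic : ∀ x ∈ Ω, u x 0 = 0
  robin : ∀ x ∈ frontier Ω, ∀ ν : E2, ‖ν‖ = 1 →
    (∀ y ∈ closure Ω, (inner ℝ ν (y - x) : ℝ) ≤ 0) →
    ∀ t : ℝ, 0 < t → t ≤ T →
      k x * fderiv ℝ (fun y => u y t) x ν + μ x * u x t = 0


abbrev ee (i : Fin 2) : E2 := EuclideanSpace.single i (1:ℝ)

lemma grad_coord (v : E2 → ℝ) (x : E2) (i : Fin 2) : gradient v x i = fderiv ℝ v x (ee i) := by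
  have : inner ℝ (gradient v x) (ee i) = fderiv ℝ v x (ee i) := by
    simp [gradient]
  rw [← this, EuclideanSpace.inner_single_right]
  simp

lemma grad_diff (v : E2 → ℝ) (hv : ContDiff ℝ 2 v) : Differentiable ℝ (gradient v) := by
  have h : Differentiable ℝ (fderiv ℝ v) :=
    (hv.fderiv_right (m := 1) (by norm_num)).differentiable (by norm_num)
  intro x
  exact ((InnerProductSpace.toDual ℝ E2).symm.toContinuousLinearEquiv.differentiable.comp h) x

lemma ellOp_eq (k v : E2 → ℝ) (x : E2) (hk : DifferentiableAt ℝ k x) (hv : ContDiff ℝ 2 v) :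
    ellOp k v x = - ∑ i : Fin 2, (k x * fderiv ℝ (fun y => fderiv ℝ v y (ee i)) x (ee i)
      + fderiv ℝ k x (ee i) * fderiv ℝ v x (ee i)) := by
  unfold ellOp
  congr 1
  refine Finset.sum_congr rfl fun i _ => ?_
  have hg := grad_diff v hv x
  rw [fderiv_fun_smul hk hg]
  have h2 : (fun y => fderiv ℝ v y (ee i)) = fun y => (EuclideanSpace.proj i : E2 →L[ℝ] ℝ) (gradient v y) := by
    funext y; simp [grad_coord]
  have h3 : fderiv ℝ (fun y => fderiv ℝ v y (ee i)) x (ee i) = fderiv ℝ (gradient v) x (ee i) i := by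
    rw [h2]
    have := ((EuclideanSpace.proj i : E2 →L[ℝ] ℝ).hasFDerivAt.comp x hg.hasFDerivAt).fderiv
    have h4 : (fun y => (EuclideanSpace.proj i : E2 →L[ℝ] ℝ) (gradient v y)) = (EuclideanSpace.proj i : E2 →L[ℝ] ℝ) ∘ gradient v := rfl
    rw [h4, this]; simp
  rw [h3]
  simp [grad_coord]

lemma snd_deriv_nonneg (φ : ℝ → ℝ) (hφ : ContDiff ℝ 2 φ) (h : IsLocalMin φ 0) :
    0 ≤ deriv (deriv φ) 0 := by
  by_contra hn
  push Not at hn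
  have hmax := isLocalMax_of_deriv_deriv_neg hn h.deriv_eq_zero hφ.continuous.continuousAt
  have hc : φ =ᶠ[nhds 0] fun _ => φ 0 := by
    filter_upwards [h, hmax] with s h1 h2 using le_antisymm h2 h1
  have h1 := hc.deriv
  have h2 := h1.deriv_eq
  simp at h2
  linarith

lemma ellOp_min (k v : E2 → ℝ) (x : E2) (hk : DifferentiableAt ℝ k x) (hv : ContDiff ℝ 2 v)
    (hk0 : 0 ≤ k x) (h : IsLocalMin v x) : ellOp k v x ≤ 0 := by
  rw [ellOp_eq k v x hk hv, neg_nonpos]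
  refine Finset.sum_nonneg fun i _ => ?_
  rw [h.fderiv_eq_zero]
  have hline : ∀ s : ℝ, HasDerivAt (fun s : ℝ => x + s • ee i) (ee i) s := fun s => by
    simpa using ((hasDerivAt_id s).smul_const (ee i)).const_add x
  have hd : Differentiable ℝ v := hv.differentiable (by norm_num)
  have hd2 : Differentiable ℝ (fun y => fderiv ℝ v y (ee i)) :=
    ((hv.fderiv_right (m := 1) (by norm_num)).differentiable (by norm_num)).clm_apply
      (differentiable_const _)
  have h1 : deriv (fun s : ℝ => v (x + s • ee i)) = fun s => fderiv ℝ v (x + s • ee i) (ee i) := by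
    funext s
    exact ((hd _).hasFDerivAt.comp_hasDerivAt s (hline s)).deriv
  have h2 : deriv (fun s : ℝ => fderiv ℝ v (x + s • ee i) (ee i)) 0
      = fderiv ℝ (fun y => fderiv ℝ v y (ee i)) x (ee i) := by
    have := ((hd2 (x + (0:ℝ) • ee i)).hasFDerivAt.comp_hasDerivAt 0 (hline 0)).deriv
    simpa [Function.comp_def] using this
  have h3 := snd_deriv_nonneg (fun s : ℝ => v (x + s • ee i)) (by fun_prop) (by
    have : Filter.Tendsto (fun s : ℝ => x + s • ee i) (nhds 0) (nhds x) := by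
      simpa using (hline 0).continuousAt.tendsto
    have h4 := this.eventually h
    filter_upwards [h4] with s hs
    simpa using hs)
  rw [h1, h2] at h3
  simp
  positivity

lemma ellOp_add_smul (k v w : E2 → ℝ) (a : ℝ) (x : E2) (hk : DifferentiableAt ℝ k x)
    (hv : ContDiff ℝ 2 v) (hw : ContDiff ℝ 2 w) :
    ellOp k (fun y => v y + a * w y) x = ellOp k v x + a * ellOp k w x := by
  have hvw : ContDiff ℝ 2 (fun y => v y + a * w y) := by fun_prop
  rw [ellOp_eq k _ x hk hvw, ellOp_eq k v x hk hv, ellOp_eq k w x hk hw]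
  have hd : Differentiable ℝ v := hv.differentiable (by norm_num)
  have hd' : Differentiable ℝ w := hw.differentiable (by norm_num)
  have D2 : ∀ g : E2 → ℝ, ContDiff ℝ 2 g → ∀ i, Differentiable ℝ (fun y => fderiv ℝ g y (ee i)) :=
    fun g hg i => ((hg.fderiv_right (m := 1) (by norm_num)).differentiable (by norm_num)).clm_apply
      (differentiable_const _)
  have h1 : ∀ y, fderiv ℝ (fun y => v y + a * w y) y = fderiv ℝ v y + a • fderiv ℝ w y := fun y => by
    rw [fderiv_fun_add (hd y) ((hd' y).const_mul a), fderiv_const_mul (hd' y)]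
  have h2 : ∀ i, fderiv ℝ (fun y => fderiv ℝ v y (ee i) + a * fderiv ℝ w y (ee i)) x
      = fderiv ℝ (fun y => fderiv ℝ v y (ee i)) x + a • fderiv ℝ (fun y => fderiv ℝ w y (ee i)) x := fun i => by
    rw [fderiv_fun_add (D2 v hv i x) ((D2 w hw i x).const_mul a), fderiv_const_mul (D2 w hw i x)]
  simp only [h1, add_apply, smul_apply, smul_eq_mul, h2,
    Fin.sum_univ_two]
  ring

lemma ellOp_h_bound (Ω : Set E2) (hΩo : IsOpen Ω) (hΩb : Bornology.IsBounded Ω) (hΩconv : Convex ℝ Ω)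
    (k : E2 → ℝ) (hkC1 : ContDiffOn ℝ 1 k (closure Ω)) (x0 : E2) (hx0 : x0 ∈ Ω) :
    ∃ C : ℝ, 0 ≤ C ∧ ∀ x ∈ Ω, -C ≤ ellOp k (fun y => ‖y - x0‖^2) x := by
  have hcpt : IsCompact (closure Ω) := hΩb.isCompact_closure
  have hne : (interior (closure Ω)).Nonempty :=
    ⟨x0, interior_mono subset_closure (by rwa [hΩo.interior_eq])⟩
  have huniq : UniqueDiffOn ℝ (closure Ω) := uniqueDiffOn_convex hΩconv.closure hne
  have hcont := hkC1.continuousOn_fderivWithin huniq le_rfl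
  obtain ⟨C1, hC1⟩ := hcpt.exists_bound_of_continuousOn hcont
  obtain ⟨C2, hC2⟩ := hcpt.exists_bound_of_continuousOn hkC1.continuousOn
  have hid : ContinuousOn (fun y : E2 => y - x0) (closure Ω) := by fun_prop
  obtain ⟨C3, hC3⟩ := hcpt.exists_bound_of_continuousOn hid
  have n1 := (norm_nonneg _).trans (hC1 x0 (subset_closure hx0))
  have n2 := (norm_nonneg _).trans (hC2 x0 (subset_closure hx0))
  have n3 := (norm_nonneg _).trans (hC3 x0 (subset_closure hx0))
  refine ⟨4 * C2 + 4 * (C1 * C3), by positivity, fun x hx => ?_⟩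
  have hnh : closure Ω ∈ nhds x := Filter.mem_of_superset (hΩo.mem_nhds hx) subset_closure
  have hk : DifferentiableAt ℝ k x := (hkC1.contDiffAt hnh).differentiableAt (by norm_num)
  have hq : ContDiff ℝ 2 (fun y : E2 => ‖y - x0‖^2) := (contDiff_id.sub contDiff_const).norm_sq ℝ
  rw [ellOp_eq k _ x hk hq]
  have hf1 : ∀ y i, fderiv ℝ (fun y : E2 => ‖y - x0‖^2) y (ee i) = 2 * (y i - x0 i) := fun y i => by
    have := (((hasFDerivAt_id y).sub_const x0).norm_sq).fderiv
    simp only [id] at this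
    rw [this]
    simp [EuclideanSpace.inner_single_right]
  have hf2 : ∀ i, fderiv ℝ (fun y : E2 => 2 * (y i - x0 i)) x (ee i) = 2 := fun i => by
    have h := ((((EuclideanSpace.proj i : E2 →L[ℝ] ℝ).hasFDerivAt (x := x)).sub_const (x0 i)).const_mul 2).fderiv
    have h' : (fun y : E2 => 2 * (y i - x0 i)) = fun y => 2 * ((EuclideanSpace.proj i : E2 →L[ℝ] ℝ) y - x0 i) := by
      funext y; simp
    rw [h', h]; simp
  simp only [hf1, hf2]
  have hb : ∀ i, |fderiv ℝ k x (ee i) * (x i - x0 i)| ≤ C1 * C3 := fun i => by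
    rw [abs_mul]
    have e1 : |fderiv ℝ k x (ee i)| ≤ C1 := by
      have := hC1 x (subset_closure hx)
      rw [fderivWithin_of_mem_nhds hnh] at this
      refine le_trans ?_ this
      simpa using (fderiv ℝ k x).le_opNorm (ee i)
    have e2 : |x i - x0 i| ≤ C3 := by
      refine le_trans ?_ (hC3 x (subset_closure hx))
      simpa using PiLp.norm_apply_le (x - x0) i
    gcongr
  have hkx := hC2 x (subset_closure hx)
  rw [Real.norm_eq_abs] at hkx
  have := abs_le.1 hkx
  have b0 := abs_le.1 (hb 0)
  have b1 := abs_le.1 (hb 1)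
  rw [Fin.sum_univ_two]
  linarith

lemma slice_x (w : E2 → ℝ → ℝ) (hw : ContDiff ℝ 2 (Function.uncurry w)) (t : ℝ) :
    ContDiff ℝ 2 (fun y => w y t) :=
  hw.comp (contDiff_id.prodMk contDiff_const)

lemma slice_t (w : E2 → ℝ → ℝ) (hw : ContDiff ℝ 2 (Function.uncurry w)) (x : E2) :
    ContDiff ℝ 2 (w x) :=
  hw.comp ((contDiff_const (c := x)).prodMk contDiff_id)

/-- first order condition at a boundary minimum of a convex set -/
lemma exists_normal (Ω : Set E2) (hΩo : IsOpen Ω) (hΩconv : Convex ℝ Ω) (hne : Ω.Nonempty)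
    (x : E2) (hx : x ∈ frontier Ω) (v : E2 → ℝ) (hv : DifferentiableAt ℝ v x)
    (hmin : IsMinOn v (closure Ω) x) :
    ∃ ν : E2, ‖ν‖ = 1 ∧ (∀ y ∈ closure Ω, (inner ℝ ν (y - x) : ℝ) ≤ 0) ∧ fderiv ℝ v x ν ≤ 0 := by
  have hxc : x ∈ closure Ω := frontier_subset_closure hx
  have hg : ∀ y ∈ closure Ω, 0 ≤ fderiv ℝ v x (y - x) := fun y hy =>
    hmin.localize.hasFDerivWithinAt_nonneg hv.hasFDerivAt.hasFDerivWithinAt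
      (sub_mem_posTangentConeAt_of_segment_subset (hΩconv.closure.segment_subset hxc hy))
  have key : ∀ p : E2, p ≠ 0 → (∀ y ∈ closure Ω, (inner ℝ p (y - x) : ℝ) ≤ 0) →
      fderiv ℝ v x p ≤ 0 → ∃ ν : E2, ‖ν‖ = 1 ∧ (∀ y ∈ closure Ω, (inner ℝ ν (y - x) : ℝ) ≤ 0) ∧
        fderiv ℝ v x ν ≤ 0 := by
    intro p hp h1 h2
    have hpos : 0 ≤ ‖p‖⁻¹ := by positivity
    refine ⟨‖p‖⁻¹ • p, norm_smul_inv_norm hp, fun y hy => ?_, ?_⟩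
    · rw [real_inner_smul_left]
      exact mul_nonpos_of_nonneg_of_nonpos hpos (h1 y hy)
    · rw [map_smul, smul_eq_mul]
      exact mul_nonpos_of_nonneg_of_nonpos hpos h2
  have hig : ∀ z, (inner ℝ (gradient v x) z : ℝ) = fderiv ℝ v x z := fun z => by
    simp [gradient]
  by_cases h0 : gradient v x = 0
  · have hxn : x ∉ Ω := by
      have := hx.2
      rwa [hΩo.interior_eq] at this
    obtain ⟨L, hL⟩ := geometric_hahn_banach_open_point hΩconv hΩo hxn
    have hil : ∀ z, (inner ℝ ((InnerProductSpace.toDual ℝ E2).symm L) z : ℝ) = L z := fun z => by simp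
    refine key ((InnerProductSpace.toDual ℝ E2).symm L) ?_ ?_ ?_
    · intro h
      obtain ⟨a, ha⟩ := hne
      have h1 := hL a ha
      rw [← hil, ← hil, h] at h1
      simp at h1
    · intro y hy
      rw [hil, map_sub, sub_nonpos]
      exact closure_minimal (fun a ha => (hL a ha).le) (isClosed_le L.continuous continuous_const) hy
    · rw [← hig, h0]; simp
  · refine key (-gradient v x) (neg_ne_zero.2 h0) ?_ ?_
    · intro y hy
      rw [inner_neg_left, hig, neg_nonpos]
      exact hg y hy
    · rw [← hig, inner_neg_right, neg_nonpos]
      exact real_inner_self_nonneg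

lemma max_principle (Ω : Set E2) (hΩo : IsOpen Ω) (hΩb : Bornology.IsBounded Ω)
    (hΩconv : Convex ℝ Ω) (T : ℝ) (hT : 0 ≤ T)
    (k μ : E2 → ℝ) (k₁ : ℝ) (hk₁ : 0 < k₁) (hkbd : ∀ x ∈ closure Ω, k₁ ≤ k x)
    (hkC1 : ContDiffOn ℝ 1 k (closure Ω)) (hμ : ∀ x ∈ frontier Ω, 0 ≤ μ x)
    (c : E2 → ℝ) (hc : ∀ x ∈ Ω, 0 ≤ c x)
    (w : E2 → ℝ → ℝ) (hw : ContDiff ℝ 2 (Function.uncurry w))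
    (hpde : ∀ x ∈ Ω, ∀ t : ℝ, 0 < t → t ≤ T →
      0 ≤ deriv (w x) t + ellOp k (fun y => w y t) x + c x * w x t)
    (hic : ∀ x ∈ Ω, 0 ≤ w x 0)
    (hrob : ∀ x ∈ frontier Ω, ∀ ν : E2, ‖ν‖ = 1 →
      (∀ y ∈ closure Ω, (inner ℝ ν (y - x) : ℝ) ≤ 0) →
      ∀ t : ℝ, 0 < t → t ≤ T →
      k x * fderiv ℝ (fun y => w y t) x ν + μ x * w x t = 0) :
    ∀ x ∈ Ω, ∀ t : ℝ, 0 ≤ t → t ≤ T → 0 ≤ w x t := by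
  intro x0 hx0 t0 ht0 ht0T
  obtain ⟨C, hC0, hC⟩ := ellOp_h_bound Ω hΩo hΩb hΩconv k hkC1 x0 hx0
  obtain ⟨M, hM⟩ : ∃ M, M = C + 1 := ⟨_, rfl⟩
  suffices H : ∀ ε : ℝ, 0 < ε → 0 ≤ w x0 t0 + ε * (1 + M * t0 + ‖x0 - x0‖^2) by
    have hlim : Filter.Tendsto (fun ε : ℝ => w x0 t0 + ε * (1 + M * t0 + ‖x0 - x0‖^2))
        (nhdsWithin 0 (Set.Ioi 0)) (nhds (w x0 t0)) := by
      have : Continuous (fun ε : ℝ => w x0 t0 + ε * (1 + M * t0 + ‖x0 - x0‖^2)) := by fun_prop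
      have h := (this.tendsto 0).mono_left (nhdsWithin_le_nhds (s := Set.Ioi 0))
      simpa using h
    refine ge_of_tendsto hlim ?_
    filter_upwards [self_mem_nhdsWithin] with ε hε using H ε hε
  intro ε hε
  have hcpt : IsCompact (closure Ω ×ˢ Set.Icc (0:ℝ) T) := hΩb.isCompact_closure.prod isCompact_Icc
  have hzc : Continuous (fun p : E2 × ℝ => w p.1 p.2 + ε * (1 + M * p.2 + ‖p.1 - x0‖^2)) := by
    have : Continuous (fun p : E2 × ℝ => w p.1 p.2) := hw.continuous
    fun_prop
  obtain ⟨⟨x, t⟩, ⟨hx, ht⟩, hmin⟩ := hcpt.exists_isMinOn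
    ⟨(x0, t0), subset_closure hx0, ht0, ht0T⟩ hzc.continuousOn
  simp only at hx ht
  have hmin' : ∀ y ∈ closure Ω, ∀ s ∈ Set.Icc (0:ℝ) T,
      w x t + ε * (1 + M * t + ‖x - x0‖^2) ≤ w y s + ε * (1 + M * s + ‖y - x0‖^2) :=
    fun y hy s hs => hmin (show (y, s) ∈ closure Ω ×ˢ Set.Icc (0:ℝ) T from ⟨hy, hs⟩)
  refine le_trans ?_ (hmin' x0 (subset_closure hx0) t0 ⟨ht0, ht0T⟩)
  by_contra hneg
  push Not at hneg
  have hMt : 0 ≤ M * t := mul_nonneg (by linarith) ht.1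
  have hbpos : 0 < ε * (1 + M * t + ‖x - x0‖^2) := by positivity
  have hwneg : w x t < 0 := by linarith
  -- t > 0
  have htpos : 0 < t := by
    rcases ht.1.lt_or_eq with h | h
    · exact h
    · exfalso
      have : 0 ≤ w x 0 :=
        closure_minimal (t := {y | 0 ≤ w y 0}) hic
          (isClosed_le continuous_const (slice_x w hw 0).continuous) hx
      rw [← h] at hwneg
      linarith
  have hv2 : ContDiff ℝ 2 (fun y => w y t) := slice_x w hw t
  have hq2 : ContDiff ℝ 2 (fun y : E2 => ‖y - x0‖^2) := (contDiff_id.sub contDiff_const).norm_sq ℝ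
  have hmv : IsMinOn (fun y => w y t + ε * ‖y - x0‖^2) (closure Ω) x := fun y hy => by
    have := hmin' y hy t ht
    simp only [Set.mem_ofPred_eq]
    linarith
  by_cases hxO : x ∈ Ω
  · have hnh : closure Ω ∈ nhds x := Filter.mem_of_superset (hΩo.mem_nhds hxO) subset_closure
    have hk : DifferentiableAt ℝ k x := (hkC1.contDiffAt hnh).differentiableAt (by norm_num)
    have e1 := ellOp_min k _ x hk (hv2.add (contDiff_const.mul hq2)) (by linarith [hkbd x hx])
      (hmv.isLocalMin hnh)
    rw [ellOp_add_smul k _ _ ε x hk hv2 hq2] at e1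
    have e2 : deriv (w x) t + ε * M ≤ 0 := by
      have hd : HasDerivAt (fun s => w x s + ε * (1 + M * s + ‖x - x0‖^2)) (deriv (w x) t + ε * M) t := by
        have h1 := (((slice_t w hw x).differentiable (by norm_num)) t).hasDerivAt
        have h2 := (((((hasDerivAt_id t).const_mul M).const_add 1).add_const (‖x - x0‖^2)).const_mul ε)
        have h3 := h1.add h2
        simp only [mul_one] at h3
        exact h3
      have hm : IsMinOn (fun s => w x s + ε * (1 + M * s + ‖x - x0‖^2)) (Set.Icc 0 T) t :=
        fun s hs => hmin' x hx s hs
      have := hm.localize.hasFDerivWithinAt_nonneg hd.hasFDerivAt.hasFDerivWithinAt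
        (sub_mem_posTangentConeAt_of_segment_subset
          ((convex_Icc 0 T).segment_subset ht (⟨le_rfl, hT⟩ : (0:ℝ) ∈ Set.Icc 0 T)))
      simp at this
      by_contra hcon
      push Not at hcon
      nlinarith
    have e3 := hpde x hxO t htpos ht.2
    have e4 : c x * w x t ≤ 0 := mul_nonpos_of_nonneg_of_nonpos (hc x hxO) hwneg.le
    have e5 := mul_le_mul_of_nonneg_left (hC x hxO) hε.le
    rw [hM] at e2
    nlinarith
  · have hxf : x ∈ frontier Ω := ⟨hx, by rwa [hΩo.interior_eq]⟩
    have hdv := (hv2.differentiable (by norm_num)) x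
    have hdq := (hq2.differentiable (by norm_num)) x
    obtain ⟨ν, hν1, hν2, hν3⟩ := exists_normal Ω hΩo hΩconv ⟨x0, hx0⟩ x hxf _
      (hdv.add (hdq.const_mul ε)) hmv
    rw [fderiv_add hdv (hdq.const_mul ε), fderiv_const_mul hdq] at hν3
    have hq : fderiv ℝ (fun y : E2 => ‖y - x0‖^2) x ν = 2 * inner ℝ ν (x - x0) := by
      have := (((hasFDerivAt_id x).sub_const x0).norm_sq).fderiv
      simp only [id] at this
      rw [this]
      simp
      rw [real_inner_comm ν x, real_inner_comm ν x0, inner_sub_right]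
    have hpos : 0 < (inner ℝ ν (x - x0) : ℝ) := by
      obtain ⟨r, hr, hball⟩ := Metric.isOpen_iff.1 hΩo x0 hx0
      have hmem : x0 + (r/2) • ν ∈ Ω := hball (by
        simp [Metric.mem_ball, dist_eq_norm, norm_smul, hν1, abs_of_pos hr]
        linarith)
      have h1 := hν2 _ (subset_closure hmem)
      have h2 : x0 + (r/2) • ν - x = (r/2) • ν - (x - x0) := by abel
      rw [h2, inner_sub_right, inner_smul_right, real_inner_self_eq_norm_sq, hν1] at h1
      linarith
    simp only [add_apply, smul_apply, smul_eq_mul, hq] at hν3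
    have hr := hrob x hxf ν hν1 hν2 t htpos ht.2
    have hkx : 0 < k x := by linarith [hkbd x hx]
    have h1 : fderiv ℝ (fun y => w y t) x ν < 0 := by
      have : 0 < ε * (2 * inner ℝ ν (x - x0)) := by positivity
      linarith
    have h2 : μ x * w x t ≤ 0 := mul_nonpos_of_nonneg_of_nonpos (hμ x hxf) hwneg.le
    nlinarith

lemma mono_lemma (Ω : Set E2) (hΩo : IsOpen Ω) (hΩb : Bornology.IsBounded Ω)
    (hΩconv : Convex ℝ Ω) (T : ℝ) (hT : 0 < T)
    (k μ : E2 → ℝ) (k₁ : ℝ) (hk₁ : 0 < k₁) (hkbd : ∀ x ∈ closure Ω, k₁ ≤ k x)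
    (hkC1 : ContDiffOn ℝ 1 k (closure Ω)) (hμ : ∀ x ∈ frontier Ω, 0 ≤ μ x)
    (c : E2 → ℝ) (hc : ∀ x ∈ Ω, 0 ≤ c x)
    (w : E2 → ℝ → ℝ) (hw : ContDiff ℝ 2 (Function.uncurry w)) (F : E2 → ℝ → ℝ)
    (hsol : IsDirectSolution Ω T k μ c F w)
    (hF0 : ∀ x ∈ Ω, ∀ t : ℝ, 0 < t → t ≤ T → 0 ≤ F x t)
    (hFm : ∀ x ∈ Ω, ∀ s t : ℝ, 0 < s → s ≤ t → t ≤ T → F x s ≤ F x t) :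
    ∀ x ∈ Ω, (∀ t : ℝ, 0 < t → t ≤ T → 0 ≤ w x t) ∧
      (∀ s t : ℝ, 0 < s → s ≤ t → t ≤ T → w x s ≤ w x t) ∧ 0 ≤ deriv (w x) T := by
  have hpos : ∀ x ∈ Ω, ∀ t : ℝ, 0 ≤ t → t ≤ T → 0 ≤ w x t :=
    max_principle Ω hΩo hΩb hΩconv T hT.le k μ k₁ hk₁ hkbd hkC1 hμ c hc w hw
      (fun x hx t h1 h2 => by rw [hsol.pde x hx t h1 h2]; exact hF0 x hx t h1 h2)
      (fun x hx => (hsol.ic x hx).ge) hsol.robin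
  have hmono : ∀ x ∈ Ω, ∀ s t : ℝ, 0 < s → s ≤ t → t ≤ T → w x s ≤ w x t := by
    intro x hx s t hs hst htT
    obtain ⟨h, hh⟩ : ∃ h, h = t - s := ⟨_, rfl⟩
    have hh0 : 0 ≤ h := by linarith
    have hsh : ContDiff ℝ 2 (Function.uncurry (fun x t => w x (t + h))) :=
      hw.comp (contDiff_fst.prodMk (contDiff_snd.add contDiff_const))
    have := max_principle Ω hΩo hΩb hΩconv (T - h) (by linarith) k μ k₁ hk₁ hkbd hkC1 hμ c hc
      (fun x t => w x (t + h) + (-1) * w x t) (hsh.add (contDiff_const.mul hw)) ?_ ?_ ?_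
      x hx s hs.le (by linarith)
    · have e : s + h = t := by linarith
      simp only [e] at this
      linarith
    · intro y hy r hr hrT
      have hnh : closure Ω ∈ nhds y := Filter.mem_of_superset (hΩo.mem_nhds hy) subset_closure
      have hk : DifferentiableAt ℝ k y := (hkC1.contDiffAt hnh).differentiableAt (by norm_num)
      rw [ellOp_add_smul k (fun y => w y (r + h)) (fun y => w y r) (-1) y hk (slice_x w hw _) (slice_x w hw _)]
      have hd := (slice_t w hw y).differentiable (by norm_num)
      have h1 : HasDerivAt (fun t => w y (t + h)) (deriv (w y) (r + h)) r :=
        HasDerivAt.comp_add_const r h (hd (r + h)).hasDerivAt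
      have h2 := (h1.add ((hd r).hasDerivAt.const_mul (-1))).deriv
      have h3 : deriv (fun t => w y (t + h) + -1 * w y t) r = deriv (w y) (r + h) + -1 * deriv (w y) r := h2
      rw [h3]
      have p1 := hsol.pde y hy r hr (by linarith)
      have p2 := hsol.pde y hy (r + h) (by linarith) (by linarith)
      have p3 := hFm y hy r (r + h) hr (by linarith) (by linarith)
      linarith
    · intro y hy
      have := hpos y hy h hh0 (by linarith)
      simp only [zero_add, hsol.ic y hy]
      linarith
    · intro y hy ν hν hν2 r hr hrT
      have hd := fun r => (slice_x w hw r).differentiable (by norm_num) y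
      have p1 := hsol.robin y hy ν hν hν2 r hr (by linarith)
      have p2 := hsol.robin y hy ν hν hν2 (r + h) (by linarith) (by linarith)
      rw [fderiv_fun_add (hd (r + h)) ((hd r).const_mul (-1)), fderiv_const_mul (hd r)]
      simp only [add_apply, smul_apply, smul_eq_mul]
      linarith
  intro x hx
  refine ⟨fun t h1 h2 => hpos x hx t h1.le h2, hmono x hx, ?_⟩
  have hd := ((slice_t w hw x).differentiable (by norm_num) T).hasDerivAt
  have hm : IsMaxOn (w x) (Set.Icc (T/2) T) T := fun s hs =>
    hmono x hx s T (by linarith [hs.1]) hs.2 le_rfl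
  have := hm.localize.hasFDerivWithinAt_nonpos hd.hasFDerivAt.hasFDerivWithinAt
        (sub_mem_posTangentConeAt_of_segment_subset
          ((convex_Icc (T/2) T).segment_subset (⟨by linarith, le_rfl⟩ : T ∈ Set.Icc (T/2) T)
            (⟨le_rfl, by linarith⟩ : T/2 ∈ Set.Icc (T/2) T)))
  simp at this
  by_contra hcon
  push Not at hcon
  nlinarith

lemma diff_sol (Ω : Set E2) (hΩo : IsOpen Ω) (T : ℝ)
    (k μ : E2 → ℝ) (hkC1 : ContDiffOn ℝ 1 k (closure Ω))
    (c c' : E2 → ℝ) (f : E2 → ℝ → ℝ) (u u' : E2 → ℝ → ℝ)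
    (hur : ContDiff ℝ 2 (Function.uncurry u)) (hur' : ContDiff ℝ 2 (Function.uncurry u'))
    (hu : IsDirectSolution Ω T k μ c f u) (hu' : IsDirectSolution Ω T k μ c' f u') :
    IsDirectSolution Ω T k μ c (fun x t => (c' x - c x) * u' x t)
      (fun x t => u x t + (-1) * u' x t) where
  pde := by
    intro y hy r hr hrT
    have hnh : closure Ω ∈ nhds y := Filter.mem_of_superset (hΩo.mem_nhds hy) subset_closure
    have hk : DifferentiableAt ℝ k y := (hkC1.contDiffAt hnh).differentiableAt (by norm_num)
    rw [ellOp_add_smul k (fun y => u y r) (fun y => u' y r) (-1) y hk (slice_x u hur _) (slice_x u' hur' _)]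
    have hd := (slice_t u hur y).differentiable (by norm_num) r
    have hd' := (slice_t u' hur' y).differentiable (by norm_num) r
    have h3 : deriv (fun t => u y t + -1 * u' y t) r = deriv (u y) r + -1 * deriv (u' y) r :=
      (hd.hasDerivAt.add (hd'.hasDerivAt.const_mul (-1))).deriv
    rw [h3]
    have p1 := hu.pde y hy r hr hrT
    have p2 := hu'.pde y hy r hr hrT
    linarith
  ic := fun x hx => by simp [hu.ic x hx, hu'.ic x hx]
  robin := by
    intro y hy ν hν hν2 r hr hrT
    have hd := (slice_x u hur r).differentiable (by norm_num) y
    have hd' := (slice_x u' hur' r).differentiable (by norm_num) y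
    have p1 := hu.robin y hy ν hν hν2 r hr hrT
    have p2 := hu'.robin y hy ν hν hν2 r hr hrT
    rw [fderiv_fun_add hd (hd'.const_mul (-1)), fderiv_const_mul hd']
    simp only [add_apply, smul_apply, smul_eq_mul]
    linarith

/-- Theorem 1: the iterative process with the initial approximation (16)
is monotone: for every `k ≥ 1`, `u ≥ uᵏ ≥ uᵏ⁻¹` on `Ω × (0,T]` and
`c ≤ cᵏ ≤ cᵏ⁻¹` on `Ω`. -/
theorem iteration_monotone_from_above
    (Ω : Set E2) (hΩo : IsOpen Ω) (hΩb : Bornology.IsBounded Ω) (hΩconv : Convex ℝ Ω)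
    (T : ℝ) (hT : 0 < T)
    (k μ : E2 → ℝ) (k₁ k₂ : ℝ) (hk₁ : 0 < k₁)
    (hkbd : ∀ x ∈ closure Ω, k₁ ≤ k x ∧ k x ≤ k₂)
    (hkC1 : ContDiffOn ℝ 1 k (closure Ω))
    (hμ : ∀ x ∈ frontier Ω, 0 ≤ μ x)
    (f : E2 → ℝ → ℝ) (hf : ContDiff ℝ (⊤ : ℕ∞) (Function.uncurry f))
    (c : E2 → ℝ) (hc : ∀ x ∈ Ω, 0 ≤ c x)
    (u : E2 → ℝ → ℝ) (hureg : ContDiff ℝ (⊤ : ℕ∞) (Function.uncurry u))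
    (hu : IsDirectSolution Ω T k μ c f u)
    (hf0 : ∀ x ∈ Ω, f x 0 = 0)
    (hft : ∀ x ∈ Ω, ∀ t : ℝ, 0 ≤ t → t ≤ T → 0 < deriv (f x) t)
    (ψ : E2 → ℝ) (hψdef : ∀ x, ψ x = u x T) (hψpos : ∀ x ∈ Ω, 0 < ψ x)
    (cs : ℕ → E2 → ℝ) (us : ℕ → E2 → ℝ → ℝ)
    (hsol : ∀ n : ℕ, IsDirectSolution Ω T k μ (cs n) f (us n))
    (hregs : ∀ n : ℕ, ContDiff ℝ (⊤ : ℕ∞) (Function.uncurry (us n)))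
    (hiter : ∀ n : ℕ, ∀ x ∈ Ω,
      cs (n + 1) x * ψ x = - deriv (us n x) T - ellOp k ψ x + f x T)
    (hinit : ∀ x ∈ Ω, cs 0 x * ψ x = - ellOp k ψ x + f x T) :
    ∀ n : ℕ, 1 ≤ n → ∀ x ∈ Ω,
      (∀ t : ℝ, 0 < t → t ≤ T → us n x t ≤ u x t ∧ us (n - 1) x t ≤ us n x t) ∧
        (c x ≤ cs n x ∧ cs n x ≤ cs (n - 1) x) := by
  have hfd : ∀ x, Differentiable ℝ (f x) := fun x =>
    (slice_t f (contDiff_infty.1 hf 2) x).differentiable (by norm_num)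
  have hfm : ∀ x ∈ Ω, MonotoneOn (f x) (Set.Icc 0 T) := fun x hx =>
    monotoneOn_of_deriv_nonneg (convex_Icc 0 T) (hfd x).continuous.continuousOn
      (hfd x).differentiableOn (fun t ht => by
        rw [interior_Icc] at ht
        exact (hft x hx t ht.1.le ht.2.le).le)
  have hfm' : ∀ x ∈ Ω, ∀ s t : ℝ, 0 < s → s ≤ t → t ≤ T → f x s ≤ f x t :=
    fun x hx s t h0 h1 h2 => hfm x hx ⟨h0.le, h1.trans h2⟩ ⟨h0.le.trans h1, h2⟩ h1
  have hfp : ∀ x ∈ Ω, ∀ t : ℝ, 0 < t → t ≤ T → 0 ≤ f x t := fun x hx t h0 h1 => by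
    rw [← hf0 x hx]
    exact hfm x hx ⟨le_rfl, hT.le⟩ ⟨h0.le, h1⟩ h0.le
  have hur : ContDiff ℝ 2 (Function.uncurry u) := contDiff_infty.1 hureg 2
  have hrs : ∀ n, ContDiff ℝ 2 (Function.uncurry (us n)) := fun n =>
    contDiff_infty.1 (hregs n) 2
  have ML := fun c hc w hw F hs hF0 hFm => mono_lemma Ω hΩo hΩb hΩconv T hT k μ k₁ hk₁
    (fun x hx => (hkbd x hx).1) hkC1 hμ c hc w hw F hs hF0 hFm
  -- comparison of two solutions
  have CMP : ∀ (a b : E2 → ℝ) (p q : E2 → ℝ → ℝ), (∀ x ∈ Ω, 0 ≤ a x) → (∀ x ∈ Ω, a x ≤ b x) →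
      ContDiff ℝ 2 (Function.uncurry p) → ContDiff ℝ 2 (Function.uncurry q) →
      IsDirectSolution Ω T k μ a f p → IsDirectSolution Ω T k μ b f q →
      ∀ x ∈ Ω, (∀ t : ℝ, 0 < t → t ≤ T → q x t ≤ p x t) ∧ deriv (q x) T ≤ deriv (p x) T := by
    intro a b p q ha hab hp hq hsp hsq x hx
    have hQ := ML b (fun x hx => (ha x hx).trans (hab x hx)) q hq f hsq hfp hfm'
    have hW := ML a ha _ (hp.add (contDiff_const.mul hq)) _
      (diff_sol Ω hΩo T k μ hkC1 a b f p q hp hq hsp hsq)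
      (fun x hx t h0 h1 => mul_nonneg (sub_nonneg.2 (hab x hx)) ((hQ x hx).1 t h0 h1))
      (fun x hx s t h0 h1 h2 => mul_le_mul_of_nonneg_left ((hQ x hx).2.1 s t h0 h1 h2)
        (sub_nonneg.2 (hab x hx))) x hx
    refine ⟨fun t h0 h1 => by linarith [hW.1 t h0 h1], ?_⟩
    have hd := (slice_t p hp x).differentiable (by norm_num) T
    have hd' := (slice_t q hq x).differentiable (by norm_num) T
    have h3 : deriv (fun t => p x t + -1 * q x t) T = deriv (p x) T + -1 * deriv (q x) T :=
      (hd.hasDerivAt.add (hd'.hasDerivAt.const_mul (-1))).deriv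
    have := hW.2.2
    rw [h3] at this
    linarith
  have hex : ∀ x ∈ Ω, c x * ψ x = - deriv (u x) T - ellOp k ψ x + f x T := fun x hx => by
    have h := hu.pde x hx T hT le_rfl
    have : ψ = fun y => u y T := funext hψdef
    rw [this]
    linarith
  have hle : ∀ n, ∀ x ∈ Ω, c x ≤ cs n x := by
    intro n
    induction n with
    | zero =>
      intro x hx
      have h1 := (ML c hc u hur f hu hfp hfm' x hx).2.2
      refine le_of_mul_le_mul_right ?_ (hψpos x hx)
      rw [hex x hx, hinit x hx]
      linarith
    | succ n ih =>
      intro x hx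
      have h1 := (CMP c (cs n) u (us n) hc ih hur (hrs n) hu (hsol n) x hx).2
      refine le_of_mul_le_mul_right ?_ (hψpos x hx)
      rw [hex x hx, hiter n x hx]
      linarith
  have hnn : ∀ n, ∀ x ∈ Ω, 0 ≤ cs n x := fun n x hx => (hc x hx).trans (hle n x hx)
  have hdec : ∀ n, ∀ x ∈ Ω, cs (n + 1) x ≤ cs n x := by
    intro n
    induction n with
    | zero =>
      intro x hx
      have h1 := (ML (cs 0) (hnn 0) (us 0) (hrs 0) f (hsol 0) hfp hfm' x hx).2.2
      refine le_of_mul_le_mul_right ?_ (hψpos x hx)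
      rw [hiter 0 x hx, hinit x hx]
      linarith
    | succ n ih =>
      intro x hx
      have h1 := (CMP (cs (n + 1)) (cs n) (us (n + 1)) (us n) (hnn _) ih (hrs _) (hrs _)
        (hsol _) (hsol _) x hx).2
      refine le_of_mul_le_mul_right ?_ (hψpos x hx)
      rw [hiter (n + 1) x hx, hiter n x hx]
      linarith
  intro n hn x hx
  obtain ⟨m, rfl⟩ : ∃ m, n = m + 1 := ⟨n - 1, by omega⟩
  rw [Nat.add_sub_cancel]
  refine ⟨fun t h0 h1 => ⟨?_, ?_⟩, hle _ x hx, hdec m x hx⟩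
  · exact (CMP c (cs (m + 1)) u (us (m + 1)) hc (hle _) hur (hrs _) hu (hsol _) x hx).1 t h0 h1
  · exact (CMP (cs (m + 1)) (cs m) (us (m + 1)) (us m) (hnn _) (hdec m) (hrs _) (hrs _)
        (hsol _) (hsol _) x hx).1 t h0 h1

end
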